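/- arXiv:1912.03532 — 3 statements merged into one kernel-verified Lean document; each statement's English description precedes it below -/
import Mathlib

section
/- Let n, m, d ∈ ℕ with n ≥ 2 and d < n − m, and let R ∈ (0,1). Let f : (0,1) → [0,∞) be a non-increasing measurable function with ∫₀¹ f(s)^{n−d} ds ≤ 1. Then: (a) f(t) ≤ t^{−1/(n−d)} for every t ∈ (0,1); (b) there exists a constant C depending only on n such that for every i ∈ {0, 1, …, m−1} and every t ∈ (0,R): (1/(m−1−i)!) ∫_t^R f(s) s^{−m} (s−t)^{m−1−i} ds ≤ C · t^{−i − 1/(n−d)}. In particular the function Hf(t) = χ_{(0,R)}(t) · (1/(m−1)!) ∫_t^R f(s) s^{−m} (s−t)^{m−1} ds is m-times weakly differentiable on (0,1), its i-th derivative on (0,R) equals (−1)^i/(m−1−i)! ∫_t^R f(s) s^{−m} (s−t)^{m−1−i} ds for i ≤ m−1 and (−1)^m f(t) t^{−m} a.e. for i = m, and |(Hf)^{(i)}(t)| ≤ C t^{−i−1/(n−d)} a.e. on (0,1) for i = 0,…,m. -/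
open MeasureTheory Set
open scoped ENNReal NNReal

/-- A non-increasing `f ≥ 0` on `(0,1)` with `∫₀¹ f ^ p ≤ 1` satisfies `f t ≤ t ^ (-1/p)`. -/
theorem AntitoneOn.le_rpow_of_lintegral_pow_le_one {f : ℝ → ℝ} {p : ℕ} (hp : p ≠ 0)
    (hf0 : ∀ t ∈ Ioo (0 : ℝ) 1, 0 ≤ f t) (hf : AntitoneOn f (Ioo 0 1))
    (hint : (∫⁻ t in Ioo (0 : ℝ) 1, ENNReal.ofReal (f t ^ p)) ≤ 1) {t : ℝ}
    (ht : t ∈ Ioo (0 : ℝ) 1) : f t ≤ t ^ (-(1 / (p : ℝ))) := by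
  have h1 : ENNReal.ofReal (f t ^ p) * ENNReal.ofReal t ≤ 1 := by
    calc ENNReal.ofReal (f t ^ p) * ENNReal.ofReal t
        = ∫⁻ _ in Ioo (0 : ℝ) t, ENNReal.ofReal (f t ^ p) := by simp
      _ ≤ ∫⁻ s in Ioo (0 : ℝ) t, ENNReal.ofReal (f s ^ p) := by
          refine setLIntegral_mono' measurableSet_Ioo fun s hs => ?_
          have hs1 : s ∈ Ioo (0 : ℝ) 1 := ⟨hs.1, hs.2.trans ht.2⟩
          exact ENNReal.ofReal_le_ofReal
            (pow_le_pow_left₀ (hf0 t ht) (hf hs1 ht hs.2.le) p)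
      _ ≤ ∫⁻ s in Ioo (0 : ℝ) 1, ENNReal.ofReal (f s ^ p) :=
          lintegral_mono_set (Ioo_subset_Ioo_right ht.2.le)
      _ ≤ 1 := hint
  have h2 : f t ^ p * t ≤ 1 := by
    rw [← ENNReal.ofReal_mul (pow_nonneg (hf0 t ht) p)] at h1
    simpa using h1
  have h3 : f t ^ p ≤ t⁻¹ := by
    rw [← one_div]
    exact (le_div_iff₀ ht.1).2 h2
  calc f t = (f t ^ p) ^ ((p : ℝ)⁻¹) := (Real.pow_rpow_inv_natCast (hf0 t ht) hp).symm
    _ ≤ t⁻¹ ^ ((p : ℝ)⁻¹) :=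
        Real.rpow_le_rpow (pow_nonneg (hf0 t ht) p) h3 (by positivity)
    _ = t ^ (-(1 / (p : ℝ))) := by
        rw [Real.inv_rpow ht.1.le, ← Real.rpow_neg ht.1.le, one_div]

/-- The kernel estimate for `f` dominated by the power `s ^ (-q)`. -/
theorem integral_kernel_le {f : ℝ → ℝ} (hfm : Measurable f) {q t R : ℝ} (hq : 0 < q)
    (ht : 0 < t) (htR : t < R) (hf0 : ∀ s ∈ Icc t R, 0 ≤ f s)
    (hf : ∀ s ∈ Icc t R, f s ≤ s ^ (-q)) (i k : ℕ) :
    ∫ s in t..R, f s * s ^ (-((i + 1 + k : ℕ) : ℝ)) * (s - t) ^ k ≤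
      q⁻¹ * t ^ (-(i : ℝ) - q) := by
  have hpt : ∀ s ∈ Icc t R, f s * s ^ (-((i + 1 + k : ℕ) : ℝ)) * (s - t) ^ k ≤
      s ^ (-(i : ℝ) - q - 1) := by
    intro s hs
    have hs0 : 0 < s := ht.trans_le hs.1
    calc f s * s ^ (-((i + 1 + k : ℕ) : ℝ)) * (s - t) ^ k
        ≤ s ^ (-q) * s ^ (-((i + 1 + k : ℕ) : ℝ)) * s ^ k := by
          have h1 : 0 ≤ s - t := sub_nonneg.2 hs.1
          have h2 : s - t ≤ s := by linarith
          have h3 := hf s hs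
          gcongr
      _ = s ^ (-(i : ℝ) - q - 1) := by
          rw [← Real.rpow_natCast s k, ← Real.rpow_add hs0, ← Real.rpow_add hs0]
          congr 1
          push_cast
          ring
  have hnn : ∀ s ∈ Icc t R, 0 ≤ f s * s ^ (-((i + 1 + k : ℕ) : ℝ)) * (s - t) ^ k := by
    intro s hs
    have hs0 : 0 < s := ht.trans_le hs.1
    have h1 : 0 ≤ s - t := sub_nonneg.2 hs.1
    have h2 := hf0 s hs
    positivity
  have h0 : (0 : ℝ) ∉ uIcc t R := by
    rw [uIcc_of_le htR.le]
    exact fun h => absurd h.1 (not_le.2 ht)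
  have hi2 : IntervalIntegrable (fun s : ℝ => s ^ (-(i : ℝ) - q - 1)) volume t R :=
    intervalIntegral.intervalIntegrable_rpow (Or.inr h0)
  have hi1 : IntervalIntegrable
      (fun s => f s * s ^ (-((i + 1 + k : ℕ) : ℝ)) * (s - t) ^ k) volume t R := by
    refine hi2.mono_fun (by fun_prop) ?_
    refine (ae_restrict_iff' measurableSet_uIoc).2 (.of_forall fun s hs => ?_)
    rw [uIoc_of_le htR.le] at hs
    have hs' := Ioc_subset_Icc_self hs
    simp only [Real.norm_of_nonneg (hnn s hs')]
    exact (hpt s hs').trans (le_abs_self _)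
  have hi : (0 : ℝ) ≤ i := i.cast_nonneg
  calc ∫ s in t..R, f s * s ^ (-((i + 1 + k : ℕ) : ℝ)) * (s - t) ^ k
      ≤ ∫ s in t..R, s ^ (-(i : ℝ) - q - 1) :=
        intervalIntegral.integral_mono_on htR.le hi1 hi2 hpt
    _ = (t ^ (-(i : ℝ) - q) - R ^ (-(i : ℝ) - q)) / (i + q) := by
        rw [integral_rpow (Or.inr ⟨by linarith, h0⟩), sub_add_cancel, ← neg_div_neg_eq]
        congr 1 <;> ring
    _ ≤ t ^ (-(i : ℝ) - q) / q := by
        have hR : 0 ≤ R ^ (-(i : ℝ) - q) := Real.rpow_nonneg (ht.trans htR).le _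
        have ht' : 0 ≤ t ^ (-(i : ℝ) - q) := Real.rpow_nonneg ht.le _
        gcongr
        · linarith
        · linarith
    _ = q⁻¹ * t ^ (-(i : ℝ) - q) := by rw [div_eq_inv_mul]

/-- Fubini's theorem on the triangle `a < t < s ≤ b`, for the kernel `(s - t) ^ k`. -/
theorem integral_triangle_swap {g ψ : ℝ → ℝ} (hg : Measurable g) (hψ : Continuous ψ)
    {a b M : ℝ} (hab : a ≤ b) (hM : ∀ s ∈ Icc a b, |g s| ≤ M) (k : ℕ) :
    ∫ t in a..b, (∫ s in t..b, g s * (s - t) ^ k) * ψ t =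
      ∫ s in a..b, g s * ∫ t in a..s, ψ t * (s - t) ^ k := by
  set μ := volume.restrict (Ioc a b)
  let T : Set (ℝ × ℝ) := {x | x.1 < x.2}
  have hT : MeasurableSet T := measurableSet_lt measurable_fst measurable_snd
  let H : ℝ × ℝ → ℝ := T.indicator fun x => g x.2 * (x.2 - x.1) ^ k * ψ x.1
  have hHm : Measurable H := by
    refine Measurable.indicator ?_ hT
    have := hψ.measurable
    fun_prop
  obtain ⟨B, hB⟩ := isCompact_Icc.exists_bound_of_continuousOn (s := Icc a b) hψ.continuousOn
  have hH : Integrable H (μ.prod μ) := by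
    refine Integrable.of_bound hHm.aestronglyMeasurable (M * (b - a) ^ k * B) ?_
    rw [Measure.prod_restrict]
    refine (ae_restrict_iff' (measurableSet_Ioc.prod measurableSet_Ioc)).2
      (.of_forall fun x hx => ?_)
    have h1 := hM x.2 (Ioc_subset_Icc_self hx.2)
    have h2 := hB x.1 (Ioc_subset_Icc_self hx.1)
    have hM0 : 0 ≤ M := (abs_nonneg _).trans h1
    have hB0 : 0 ≤ B := (norm_nonneg _).trans h2
    have hba : 0 ≤ b - a := sub_nonneg.2 hab
    by_cases hxT : x ∈ T
    · have h3 : 0 ≤ x.2 - x.1 := sub_nonneg.2 (le_of_lt hxT)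
      have h4 : x.2 - x.1 ≤ b - a := by linarith [hx.1.1, hx.2.2]
      simp only [H, indicator_of_mem hxT, norm_mul, norm_pow, Real.norm_of_nonneg h3]
      have h1' : ‖g x.2‖ ≤ M := h1
      gcongr
    · simp only [H, indicator_of_notMem hxT, norm_zero]
      positivity
  have hswap := integral_integral_swap (f := fun t s => H (t, s)) hH
  rw [intervalIntegral.integral_of_le hab, intervalIntegral.integral_of_le hab]
  convert hswap using 1
  · refine setIntegral_congr_fun measurableSet_Ioc fun t ht => ?_
    have hrw : (fun s => H (t, s)) =
        (Ioi t).indicator fun s => g s * (s - t) ^ k * ψ t := by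
      ext s
      simp only [H, T, indicator_apply, mem_ofPred_eq, mem_Ioi]
    simp only [hrw, μ]
    rw [setIntegral_indicator measurableSet_Ioi, Ioc_inter_Ioi, max_eq_right ht.1.le,
      intervalIntegral.integral_of_le ht.2, integral_mul_const]
  · refine setIntegral_congr_fun measurableSet_Ioc fun s hs => ?_
    have hrw : (fun t => H (t, s)) =
        (Iio s).indicator fun t => g s * (ψ t * (s - t) ^ k) := by
      ext t
      simp only [H, T, indicator_apply, mem_ofPred_eq, mem_Iio]
      split_ifs <;> ring
    have hset : Ioc a b ∩ Iio s = Ioo a s := by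
      ext t
      simp only [mem_inter_iff, mem_Ioc, mem_Iio, mem_Ioo]
      exact ⟨fun h => ⟨h.1.1, h.2⟩, fun h => ⟨⟨h.1, h.2.le.trans hs.2⟩, h.2⟩⟩
    simp only [hrw, μ]
    rw [setIntegral_indicator measurableSet_Iio, hset, intervalIntegral.integral_of_le hs.1.le,
      integral_Ioc_eq_integral_Ioo, integral_const_mul]

/-- Repeated integration by parts against `(s - t) ^ (k + i) / (k + i)!`. -/
theorem integral_iteratedDeriv_mul_pow {φ : ℝ → ℝ} (hφ : ContDiff ℝ (⊤ : ℕ∞) φ) {a : ℝ}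
    (ha : ∀ j, iteratedDeriv j φ a = 0) (s : ℝ) (k i : ℕ) :
    1 / (Nat.factorial (k + i) : ℝ) * ∫ t in a..s, iteratedDeriv i φ t * (s - t) ^ (k + i) =
      1 / (Nat.factorial k : ℝ) * ∫ t in a..s, φ t * (s - t) ^ k := by
  induction i with
  | zero => simp
  | succ i ih =>
    rw [← ih]
    have hd : ∀ t, HasDerivAt (iteratedDeriv i φ) (iteratedDeriv (i + 1) φ t) t := by
      intro t
      rw [iteratedDeriv_succ]
      exact (hφ.differentiable_iteratedDeriv i (by exact_mod_cast WithTop.coe_lt_top i) t).hasDerivAt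
    have hc : ∀ j, Continuous (iteratedDeriv j φ) := fun j =>
      hφ.continuous_iteratedDeriv j (by exact_mod_cast le_top)
    have hv : ∀ t, HasDerivAt (fun t => (s - t) ^ (k + i + 1))
        (-((k + i + 1 : ℕ) * (s - t) ^ (k + i))) t := by
      intro t
      have h := HasDerivAt.fun_pow ((hasDerivAt_id t).const_sub s) (k + i + 1)
      simpa using h
    have hparts := intervalIntegral.integral_mul_deriv_eq_deriv_mul (a := a) (b := s)
      (fun t _ => hv t) (fun t _ => hd t) (Continuous.intervalIntegrable (by fun_prop) _ _)
      ((hc (i + 1)).intervalIntegrable _ _)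
    have hleft : ∫ t in a..s, iteratedDeriv (i + 1) φ t * (s - t) ^ (k + i + 1) =
        (k + i + 1 : ℕ) * ∫ t in a..s, iteratedDeriv i φ t * (s - t) ^ (k + i) := by
      rw [← intervalIntegral.integral_const_mul]
      simp only [ha i, sub_self, zero_pow (Nat.succ_ne_zero _), zero_mul, mul_zero, zero_sub,
        neg_mul, intervalIntegral.integral_neg, neg_neg] at hparts
      simpa only [mul_comm, mul_left_comm, mul_assoc] using hparts
    rw [← add_assoc, hleft, Nat.factorial_succ]
    have hfac : (Nat.factorial (k + i) : ℝ) ≠ 0 := by positivity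
    have hk : ((k + i + 1 : ℕ) : ℝ) ≠ 0 := by positivity
    rw [Nat.cast_mul]
    field_simp

/-- The case of `integral_iteratedDeriv_mul_pow` in which all derivatives are spent. -/
theorem integral_iteratedDeriv_succ_mul_pow {φ : ℝ → ℝ} (hφ : ContDiff ℝ (⊤ : ℕ∞) φ) {a : ℝ}
    (ha : ∀ j, iteratedDeriv j φ a = 0) (s : ℝ) (i : ℕ) :
    1 / (Nat.factorial i : ℝ) * ∫ t in a..s, iteratedDeriv (i + 1) φ t * (s - t) ^ i = φ s := by
  have hφ' : ContDiff ℝ (⊤ : ℕ∞) (deriv φ) := (contDiff_infty_iff_deriv.1 hφ).2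
  have h := integral_iteratedDeriv_mul_pow hφ' (a := a)
    (fun j => by rw [← iteratedDeriv_succ']; exact ha _) s 0 i
  simp only [zero_add, ← iteratedDeriv_succ'] at h
  rw [h]
  have h0 : φ a = 0 := by simpa using ha 0
  have := intervalIntegral.integral_deriv_eq_sub' φ rfl (a := a) (b := s)
    (fun x _ => (hφ.differentiable (by simp)) x) hφ'.continuous.continuousOn
  simp [this, h0]

/-- Multiplying by a function that vanishes on `(-∞, a]` restricts an integral to `(a, R)`. -/
theorem integral_indicator_Ioo_mul {G ψ : ℝ → ℝ} {a R : ℝ} (ha : 0 ≤ a) (haR : a ≤ R)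
    (hψ : ∀ t ≤ a, ψ t = 0) :
    ∫ t, (Ioo 0 R).indicator G t * ψ t = ∫ t in a..R, G t * ψ t := by
  rw [intervalIntegral.integral_of_le haR, integral_Ioc_eq_integral_Ioo,
    ← integral_indicator measurableSet_Ioo]
  congr 1
  ext t
  simp only [indicator_apply, mem_Ioo]
  by_cases hta : t ≤ a
  · simp [hψ t hta, not_lt.2 hta]
  · simp [not_le.1 hta, ha.trans_lt (not_le.1 hta)]

/-- A function supported in `(0,1)` vanishes, with its derivatives, on some `(-∞, a]`. -/
theorem exists_iteratedDeriv_eq_zero_of_tsupport_subset {φ : ℝ → ℝ}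
    (hs : tsupport φ ⊆ Ioo 0 1) {R : ℝ} (hR : 0 < R) :
    ∃ a, 0 < a ∧ a < R ∧ ∀ j, ∀ t ≤ a, iteratedDeriv j φ t = 0 := by
  have h0 : (tsupport φ)ᶜ ∈ nhds (0 : ℝ) :=
    (isClosed_tsupport φ).isOpen_compl.mem_nhds fun h => (hs h).1.false
  obtain ⟨ε, hε, hball⟩ := Metric.mem_nhds_iff.1 h0
  refine ⟨min (ε / 2) (R / 2), by positivity, ?_, fun j t ht => ?_⟩
  · exact (min_le_right _ _).trans_lt (by linarith)
  · have hnot : t ∉ tsupport φ := by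
      intro hmem
      have h1 := (hs hmem).1
      refine hball ?_ hmem
      rw [Metric.mem_ball, Real.dist_eq, sub_zero, abs_of_pos h1]
      linarith [ht.trans (min_le_left _ _)]
    have hev : φ =ᶠ[nhds t] fun _ => 0 := notMem_tsupport_iff_eventuallyEq.1 hnot
    rw [(hev.iteratedDeriv j).eq_of_nhds]
    simp

/-- Pairing the truncated kernel integral of `g` with `ψ`, which vanishes on `(-∞, a]`. -/
theorem integral_indicator_kernel_mul {g ψ : ℝ → ℝ} (hg : Measurable g) (hψ : Continuous ψ)
    {a R M : ℝ} (ha : 0 ≤ a) (haR : a ≤ R) (hM : ∀ s ∈ Icc a R, |g s| ≤ M)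
    (hψ0 : ∀ t ≤ a, ψ t = 0) (c : ℝ) (k : ℕ) :
    ∫ t, (Ioo 0 R).indicator (fun t => c * ∫ s in t..R, g s * (s - t) ^ k) t * ψ t =
      ∫ s in a..R, g s * (c * ∫ t in a..s, ψ t * (s - t) ^ k) := by
  rw [integral_indicator_Ioo_mul ha haR hψ0]
  simp only [mul_assoc, mul_left_comm (g _) c, intervalIntegral.integral_const_mul]
  rw [integral_triangle_swap hg hψ haR hM]

/-- **Pointwise estimates for the operator `H` on the class `Λ_{n,d}`.**
(a) every `f ∈ Λ_{n,d}` satisfies `f(t) ≤ t^{-1/(n-d)}`;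
(b) the truncated kernels of `H` obey `|(Hf)^{(i)}(t)| ≤ C t^{-i-1/(n-d)}` with `C = C(n)`;
moreover `Hf` is `m`-times weakly differentiable on `(0,1)` with the stated derivatives. -/
theorem H_operator_derivative_estimates (n : ℕ) (hn : 2 ≤ n) :
    ∃ C : ℝ, 0 < C ∧
      ∀ m d : ℕ, 1 ≤ m → d + m < n →
      ∀ R : ℝ, R ∈ Set.Ioo (0 : ℝ) 1 →
      ∀ f : ℝ → ℝ, Measurable f → (∀ t ∈ Set.Ioo (0 : ℝ) 1, 0 ≤ f t) →
        AntitoneOn f (Set.Ioo 0 1) →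
        (∫⁻ t in Set.Ioo (0 : ℝ) 1, ENNReal.ofReal (f t ^ (n - d))) ≤ 1 →
        -- (a)
        ((∀ t ∈ Set.Ioo (0 : ℝ) 1, f t ≤ t ^ (-(1 / ((n : ℝ) - d)))) ∧
        -- (b)
        (∀ i : ℕ, i ≤ m - 1 → ∀ t ∈ Set.Ioo (0 : ℝ) R,
          (1 / (Nat.factorial (m - 1 - i) : ℝ)) *
              ∫ s in t..R, f s * s ^ (-(m : ℝ)) * (s - t) ^ (m - 1 - i)
            ≤ C * t ^ (-(i : ℝ) - 1 / ((n : ℝ) - d))) ∧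
        -- weak differentiability of `Hf` on `(0,1)`, with the stated `i`-th derivatives
        (∀ i : ℕ, i ≤ m → ∀ φ : ℝ → ℝ, ContDiff ℝ (⊤ : ℕ∞) φ →
          tsupport φ ⊆ Set.Ioo 0 1 →
          (∫ t, Set.indicator (Set.Ioo 0 R)
              (fun t => (1 / (Nat.factorial (m - 1) : ℝ)) *
                ∫ s in t..R, f s * s ^ (-(m : ℝ)) * (s - t) ^ (m - 1)) t *
              iteratedDeriv i φ t) =
            (-1 : ℝ) ^ i *
              ∫ t, Set.indicator (Set.Ioo 0 R)
                (fun t => if i < m then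
                    (-1 : ℝ) ^ i / (Nat.factorial (m - 1 - i) : ℝ) *
                      ∫ s in t..R, f s * s ^ (-(m : ℝ)) * (s - t) ^ (m - 1 - i)
                  else (-1 : ℝ) ^ m * f t * t ^ (-(m : ℝ))) t * φ t) ∧
        -- bounds for all the derivatives of `Hf` up to order `m`
        (∀ i : ℕ, i ≤ m → ∀ t ∈ Set.Ioo (0 : ℝ) R,
          |if i < m then
              (-1 : ℝ) ^ i / (Nat.factorial (m - 1 - i) : ℝ) *
                ∫ s in t..R, f s * s ^ (-(m : ℝ)) * (s - t) ^ (m - 1 - i)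
            else (-1 : ℝ) ^ m * f t * t ^ (-(m : ℝ))| ≤
            C * t ^ (-(i : ℝ) - 1 / ((n : ℝ) - d)))) := by
  refine ⟨n, by positivity, fun m d hm hdm R hR f hfm hf0 hfa hint => ?_⟩
  have hcast : (n : ℝ) - d = ((n - d : ℕ) : ℝ) := (Nat.cast_sub (by omega)).symm
  have hp : 0 < n - d := by omega
  have hp' : (0 : ℝ) < ((n - d : ℕ) : ℝ) := by exact_mod_cast hp
  simp only [hcast]
  set q : ℝ := 1 / ((n - d : ℕ) : ℝ) with hq
  have hq0 : 0 < q := by positivity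
  have hqn : q⁻¹ ≤ n := by simp [hq]
  have hA : ∀ t ∈ Ioo (0 : ℝ) 1, f t ≤ t ^ (-q) := fun t ht =>
    hfa.le_rpow_of_lintegral_pow_le_one hp.ne' hf0 hint ht
  have hsub : ∀ t ∈ Ioo (0 : ℝ) R, ∀ s ∈ Icc t R, s ∈ Ioo (0 : ℝ) 1 := fun t ht s hs =>
    ⟨ht.1.trans_le hs.1, hs.2.trans_lt hR.2⟩
  have hB : ∀ i : ℕ, i < m → ∀ t ∈ Ioo (0 : ℝ) R,
      (1 / (Nat.factorial (m - 1 - i) : ℝ)) *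
          ∫ s in t..R, f s * s ^ (-(m : ℝ)) * (s - t) ^ (m - 1 - i)
        ≤ n * t ^ (-(i : ℝ) - q) := by
    intro i hi t ht
    have hk := integral_kernel_le hfm hq0 ht.1 ht.2 (fun s hs => hf0 s (hsub t ht s hs))
      (fun s hs => hA s (hsub t ht s hs)) i (m - 1 - i)
    rw [show i + 1 + (m - 1 - i) = m by omega] at hk
    have hfac : 1 / (Nat.factorial (m - 1 - i) : ℝ) ≤ 1 := by
      rw [div_le_one (by positivity)]
      exact_mod_cast Nat.factorial_pos _
    have ht0 : 0 ≤ t ^ (-(i : ℝ) - q) := Real.rpow_nonneg ht.1.le _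
    have hr : 0 ≤ (n : ℝ) * t ^ (-(i : ℝ) - q) := by positivity
    calc _ ≤ (1 / (Nat.factorial (m - 1 - i) : ℝ)) * (n * t ^ (-(i : ℝ) - q)) := by
          have := hk.trans (mul_le_mul_of_nonneg_right hqn ht0)
          gcongr
      _ ≤ _ := mul_le_of_le_one_left hr hfac
  refine ⟨hA, fun i hi => hB i (by omega), ?_, ?_⟩
  · intro i hi φ hφ hsupp
    obtain ⟨a, ha, haR, hvan⟩ := exists_iteratedDeriv_eq_zero_of_tsupport_subset hsupp hR.1
    have hgm : Measurable fun s => f s * s ^ (-(m : ℝ)) := by fun_prop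
    have hM : ∀ s ∈ Icc a R, |f s * s ^ (-(m : ℝ))| ≤ f a * a ^ (-(m : ℝ)) := by
      intro s hs
      have hs1 := hsub a ⟨ha, haR⟩ s hs
      have ha1 := hsub a ⟨ha, haR⟩ a ⟨le_rfl, haR.le⟩
      have hs0 := Real.rpow_nonneg hs1.1.le (-(m : ℝ))
      rw [abs_of_nonneg (mul_nonneg (hf0 s hs1) hs0)]
      exact mul_le_mul (hfa ha1 hs1 hs.1)
        (Real.rpow_le_rpow_of_nonpos ha hs.1 (by simp)) hs0 (hf0 a ha1)
    have hφ0 : ∀ t ≤ a, φ t = 0 := fun t ht => by simpa using hvan 0 t ht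
    have hc : Continuous (iteratedDeriv i φ) :=
      hφ.continuous_iteratedDeriv i (by exact_mod_cast le_top)
    have hsign : ((-1 : ℝ) ^ i) * (-1) ^ i = 1 := by rw [← mul_pow]; simp
    have hva : ∀ j, iteratedDeriv j φ a = 0 := fun j => hvan j a le_rfl
    rw [integral_indicator_kernel_mul hgm hc ha.le haR.le hM (hvan i)]
    rcases hi.lt_or_eq with him | rfl
    · simp only [if_pos him]
      rw [integral_indicator_kernel_mul hgm hφ.continuous ha.le haR.le hM hφ0,
        ← intervalIntegral.integral_const_mul]
      refine intervalIntegral.integral_congr fun s _ => ?_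
      have h := integral_iteratedDeriv_mul_pow hφ hva s (m - 1 - i) i
      rw [show m - 1 - i + i = m - 1 by omega] at h
      simp only [h]
      linear_combination (-(f s * s ^ (-(m : ℝ)) * (1 / (Nat.factorial (m - 1 - i) : ℝ) *
        ∫ t in a..s, φ t * (s - t) ^ (m - 1 - i)))) * hsign
    · simp only [lt_irrefl, if_false]
      rw [integral_indicator_Ioo_mul ha.le haR.le hφ0, ← intervalIntegral.integral_const_mul]
      refine intervalIntegral.integral_congr fun s _ => ?_
      have h := integral_iteratedDeriv_succ_mul_pow hφ hva s (i - 1)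
      rw [Nat.sub_add_cancel hm] at h
      simp only [h]
      linear_combination (-(f s * s ^ (-(i : ℝ)) * φ s)) * hsign
  · intro i hi t ht
    have ht1 := hsub t ht t ⟨le_rfl, ht.2.le⟩
    rcases hi.lt_or_eq with him | rfl
    · rw [if_pos him]
      have hnn : 0 ≤ ∫ s in t..R, f s * s ^ (-(m : ℝ)) * (s - t) ^ (m - 1 - i) := by
        refine intervalIntegral.integral_nonneg ht.2.le fun s hs => ?_
        have hs1 := hsub t ht s hs
        exact mul_nonneg (mul_nonneg (hf0 s hs1) (Real.rpow_nonneg hs1.1.le _))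
          (pow_nonneg (sub_nonneg.2 hs.1) _)
      rw [abs_mul, abs_div, abs_of_nonneg hnn, abs_pow, abs_neg, abs_one, one_pow, Nat.abs_cast]
      exact hB i him t ht
    · rw [if_neg (lt_irrefl _), abs_mul, abs_mul, abs_pow, abs_neg, abs_one, one_pow, one_mul,
        abs_of_nonneg (hf0 t ht1), abs_of_nonneg (Real.rpow_nonneg ht.1.le _)]
      have ht0 : 0 ≤ t ^ (-(i : ℝ)) := Real.rpow_nonneg ht.1.le _
      calc f t * t ^ (-(i : ℝ)) ≤ t ^ (-q) * t ^ (-(i : ℝ)) :=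
            mul_le_mul_of_nonneg_right (hA t ht1) ht0
        _ = t ^ (-(i : ℝ) - q) := by
            rw [← Real.rpow_add ht.1]
            congr 1
            ring
        _ ≤ n * t ^ (-(i : ℝ) - q) :=
            le_mul_of_one_le_left (Real.rpow_nonneg ht.1.le _)
              (by exact_mod_cast (show 1 ≤ n by omega))
end

section
/- Let n, m, d ∈ ℕ with n ≥ 2 and d < n − m, and let R ∈ (0,1). Define, for a non-increasing measurable f : (0,1) → [0,∞), the function Hf(t) = χ_{(0,R)}(t) · (1/(m−1)!) ∫_t^R f(s) s^{−m} (s−t)^{m−1} ds for t ∈ (0,1). Then there exists a constant C depending only on m, n, d, R such that ∫₀¹ (Hf(t))^{n−d} dt ≤ C for every f ∈ Λ_{n,d}, i.e. sup_{f ∈ Λ_{n,d}} ‖Hf‖_{L^{n−d}(0,1)} < ∞. -/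
open MeasureTheory Set
open scoped ENNReal NNReal

/-- Hölder's inequality for `∫ₜ^∞ g(s) / s ds`, split with the weight `s ^ (1 / (2 p))`. -/
theorem lintegral_Ioi_mul_inv_rpow_le {p : ℝ} (hp : 1 < p) {g : ℝ → ℝ≥0∞} (hg : Measurable g)
    {t : ℝ} (ht : 0 < t) :
    (∫⁻ s in Ioi t, g s * ENNReal.ofReal s⁻¹) ^ p ≤
      ENNReal.ofReal ((2 * (p - 1)) ^ (p - 1)) * (ENNReal.ofReal (t ^ (-(1 / 2) : ℝ)) *
        ∫⁻ s in Ioi t, g s ^ p * ENNReal.ofReal (s ^ (-(1 / 2) : ℝ))) := by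
  have hp0 : 0 < p := by linarith
  have hp1 : 0 < p - 1 := by linarith
  set q : ℝ := p / (p - 1) with hq
  have hpq : p.HolderConjugate q := Real.HolderConjugate.conjExponent hp
  have hq0 : 0 < q := hpq.symm.pos
  have hsplit : ∫⁻ s in Ioi t, g s * ENNReal.ofReal s⁻¹ =
      ∫⁻ s in Ioi t, ((fun s => g s * ENNReal.ofReal (s ^ (-(1 / (2 * p))))) *
        fun s => ENNReal.ofReal (s ^ (-(1 - 1 / (2 * p))))) s := by
    refine setLIntegral_congr_fun measurableSet_Ioi fun s hs => ?_
    have hs0 : 0 < s := ht.trans hs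
    simp only [Pi.mul_apply]
    rw [mul_assoc, ← ENNReal.ofReal_mul (by positivity), ← Real.rpow_add hs0, ← Real.rpow_neg_one]
    ring_nf
  have hfirst : ∫⁻ s in Ioi t, (g s * ENNReal.ofReal (s ^ (-(1 / (2 * p))))) ^ p =
      ∫⁻ s in Ioi t, g s ^ p * ENNReal.ofReal (s ^ (-(1 / 2) : ℝ)) := by
    refine setLIntegral_congr_fun measurableSet_Ioi fun s hs => ?_
    have hs0 : 0 < s := ht.trans hs
    rw [ENNReal.mul_rpow_of_nonneg _ _ hp0.le,
      ENNReal.ofReal_rpow_of_nonneg (by positivity) hp0.le, ← Real.rpow_mul hs0.le]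
    congr 3
    field_simp
  have hexp : -(1 - 1 / (2 * p)) * q = -(1 / (2 * (p - 1))) - 1 := by
    rw [hq]; field_simp; ring
  have hlt : -(1 / (2 * (p - 1))) - 1 < -1 := by
    have : 0 < 1 / (2 * (p - 1)) := by positivity
    linarith
  have hsecond : ∫⁻ s in Ioi t, ENNReal.ofReal (s ^ (-(1 - 1 / (2 * p)))) ^ q =
      ENNReal.ofReal (2 * (p - 1) * t ^ (-(1 / (2 * (p - 1))))) := by
    have : ∫⁻ s in Ioi t, ENNReal.ofReal (s ^ (-(1 - 1 / (2 * p)))) ^ q =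
        ∫⁻ s in Ioi t, ENNReal.ofReal (s ^ (-(1 / (2 * (p - 1))) - 1)) := by
      refine setLIntegral_congr_fun measurableSet_Ioi fun s hs => ?_
      have hs0 : 0 < s := ht.trans hs
      rw [ENNReal.ofReal_rpow_of_nonneg (by positivity) hq0.le, ← Real.rpow_mul hs0.le, hexp]
    rw [this, ← ofReal_integral_eq_lintegral_ofReal (integrableOn_Ioi_rpow_of_lt hlt ht),
      integral_Ioi_rpow_of_lt hlt ht]
    · congr 1
      rw [sub_add_cancel]
      field_simp
    · filter_upwards [ae_restrict_mem measurableSet_Ioi] with s hs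
      exact Real.rpow_nonneg (ht.trans hs).le _
  calc (∫⁻ s in Ioi t, g s * ENNReal.ofReal s⁻¹) ^ p
      ≤ ((∫⁻ s in Ioi t, g s ^ p * ENNReal.ofReal (s ^ (-(1 / 2) : ℝ))) ^ (1 / p) *
          ENNReal.ofReal (2 * (p - 1) * t ^ (-(1 / (2 * (p - 1))))) ^ (1 / q)) ^ p := by
        rw [hsplit, ← hfirst, ← hsecond]
        refine ENNReal.rpow_le_rpow (ENNReal.lintegral_mul_le_Lp_mul_Lq _ hpq ?_ ?_) hp0.le
        · fun_prop
        · fun_prop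
    _ = _ := by
        rw [ENNReal.mul_rpow_of_nonneg _ _ hp0.le, ← ENNReal.rpow_mul, ← ENNReal.rpow_mul,
          one_div_mul_cancel hp0.ne', ENNReal.rpow_one,
          show 1 / q * p = p - 1 by rw [hq]; field_simp,
          ENNReal.ofReal_rpow_of_nonneg (by positivity) hp1.le,
          Real.mul_rpow (by positivity) (by positivity), ← Real.rpow_mul ht.le,
          show -(1 / (2 * (p - 1))) * (p - 1) = -(1 / 2) by field_simp,
          ENNReal.ofReal_mul (by positivity)]
        ring

/-- The dual Hardy inequality on `(0, ∞)`, with a non-optimal constant. -/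
theorem lintegral_lintegral_Ioi_mul_inv_rpow_le {p : ℝ} (hp : 1 < p) {g : ℝ → ℝ≥0∞}
    (hg : Measurable g) :
    ∫⁻ t in Ioi (0 : ℝ), (∫⁻ s in Ioi t, g s * ENNReal.ofReal s⁻¹) ^ p ≤
      ENNReal.ofReal ((2 * (p - 1)) ^ (p - 1) * 2) * ∫⁻ s in Ioi (0 : ℝ), g s ^ p := by
  have hp1 : 0 < p - 1 := by linarith
  set K : ℝ → ℝ → ℝ≥0∞ := fun t s => if t < s then
    ENNReal.ofReal (t ^ (-(1 / 2) : ℝ)) * (g s ^ p * ENNReal.ofReal (s ^ (-(1 / 2) : ℝ))) else 0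
    with hK
  have hKm : Measurable (Function.uncurry K) := by
    refine Measurable.ite (measurableSet_lt measurable_fst measurable_snd) ?_ measurable_const
    fun_prop
  have hrow : ∀ t ∈ Ioi (0 : ℝ), ENNReal.ofReal (t ^ (-(1 / 2) : ℝ)) *
      ∫⁻ s in Ioi t, g s ^ p * ENNReal.ofReal (s ^ (-(1 / 2) : ℝ)) =
      ∫⁻ s in Ioi (0 : ℝ), K t s := by
    intro t ht
    rw [← lintegral_const_mul' _ _ ENNReal.ofReal_ne_top, ← lintegral_indicator measurableSet_Ioi,
      ← lintegral_indicator measurableSet_Ioi]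
    congr 1 with s
    by_cases hs : t < s
    · have : 0 < s := lt_trans ht hs
      simp [hK, hs, this]
    · simp [hK, hs, indicator]
  have hcol : ∀ s ∈ Ioi (0 : ℝ), ∫⁻ t in Ioi (0 : ℝ), K t s = ENNReal.ofReal 2 * g s ^ p := by
    intro s hs
    have hs0 : (0 : ℝ) < s := hs
    have hI : ∫⁻ t in Ioo (0 : ℝ) s, ENNReal.ofReal (t ^ (-(1 / 2) : ℝ)) =
        ENNReal.ofReal (2 * s ^ (1 / 2 : ℝ)) := by
      have hint : IntervalIntegrable (fun t : ℝ => t ^ (-(1 / 2) : ℝ)) volume 0 s :=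
        intervalIntegral.intervalIntegrable_rpow' (by norm_num)
      rw [← setLIntegral_congr Ioo_ae_eq_Ioc.symm, ← ofReal_integral_eq_lintegral_ofReal,
        ← intervalIntegral.integral_of_le hs0.le, integral_rpow (Or.inl (by norm_num))]
      · congr 1
        norm_num
        ring
      · exact (intervalIntegrable_iff_integrableOn_Ioc_of_le hs0.le).1 hint
      · filter_upwards [ae_restrict_mem measurableSet_Ioc] with t ht
        exact Real.rpow_nonneg ht.1.le _
    have hKs : ∫⁻ t in Ioi (0 : ℝ), K t s =
        ∫⁻ t in Ioo (0 : ℝ) s, ENNReal.ofReal (t ^ (-(1 / 2) : ℝ)) *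
          (g s ^ p * ENNReal.ofReal (s ^ (-(1 / 2) : ℝ))) := by
      rw [← lintegral_indicator measurableSet_Ioi, ← lintegral_indicator measurableSet_Ioo]
      congr 1 with t
      by_cases h0 : 0 < t <;> by_cases hts : t < s <;> simp [hK, h0, hts, indicator]
    rw [hKs, lintegral_mul_const _ (by fun_prop), hI, mul_comm (g s ^ p), ← mul_assoc,
      ← ENNReal.ofReal_mul (by positivity), mul_assoc, ← Real.rpow_add hs0]
    norm_num
  calc ∫⁻ t in Ioi (0 : ℝ), (∫⁻ s in Ioi t, g s * ENNReal.ofReal s⁻¹) ^ p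
      ≤ ∫⁻ t in Ioi (0 : ℝ), ENNReal.ofReal ((2 * (p - 1)) ^ (p - 1)) *
          ∫⁻ s in Ioi (0 : ℝ), K t s := by
        refine setLIntegral_mono' measurableSet_Ioi fun t ht => ?_
        rw [← hrow t ht]
        exact lintegral_Ioi_mul_inv_rpow_le hp hg ht
    _ = ENNReal.ofReal ((2 * (p - 1)) ^ (p - 1)) *
          ∫⁻ s in Ioi (0 : ℝ), ∫⁻ t in Ioi (0 : ℝ), K t s := by
        rw [lintegral_const_mul' _ _ ENNReal.ofReal_ne_top,
          lintegral_lintegral_swap hKm.aemeasurable]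
    _ = _ := by
        rw [setLIntegral_congr_fun measurableSet_Ioi hcol,
          lintegral_const_mul' _ _ ENNReal.ofReal_ne_top, ENNReal.ofReal_mul (by positivity),
          mul_assoc]

/-- The kernel `s ^ (-m) (s - t) ^ (m - 1)` is dominated by `s⁻¹` for `0 < t ≤ s`. -/
theorem rpow_neg_mul_sub_pow_le_inv {m : ℕ} (hm : 1 ≤ m) {s t : ℝ} (ht : 0 < t) (hts : t ≤ s) :
    s ^ (-(m : ℝ)) * (s - t) ^ (m - 1) ≤ s⁻¹ := by
  have hs : 0 < s := ht.trans_le hts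
  have hpow : (s - t) ^ (m - 1) ≤ s ^ (m - 1) :=
    pow_le_pow_left₀ (by linarith) (by linarith) _
  calc s ^ (-(m : ℝ)) * (s - t) ^ (m - 1) ≤ s ^ (-(m : ℝ)) * s ^ (m - 1) := by gcongr
    _ = s⁻¹ := by
      obtain ⟨k, rfl⟩ := Nat.exists_eq_add_of_le' hm
      rw [Real.rpow_neg hs.le, Real.rpow_natCast, Nat.add_sub_cancel, pow_succ]
      field_simp

/-- **Uniform `L^{n-d}(0,1)` bound for the operator `H` on the class `Λ_{n,d}`:**
`sup_{f ∈ Λ_{n,d}} ‖Hf‖_{L^{n-d}(0,1)} < ∞`. -/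
theorem H_operator_uniformly_bounded (n m d : ℕ) (hn : 2 ≤ n) (hm : 1 ≤ m)
    (hd : d + m < n) (R : ℝ) (hR : R ∈ Set.Ioo (0 : ℝ) 1) :
    ∃ C : ℝ, 0 < C ∧
      ∀ f : ℝ → ℝ, Measurable f → (∀ t ∈ Set.Ioo (0 : ℝ) 1, 0 ≤ f t) →
        AntitoneOn f (Set.Ioo 0 1) →
        (∫⁻ t in Set.Ioo (0 : ℝ) 1, ENNReal.ofReal (f t ^ (n - d))) ≤ 1 →
        (∫⁻ t in Set.Ioo (0 : ℝ) 1,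
            ENNReal.ofReal
              ((Set.indicator (Set.Ioo 0 R)
                (fun t => (1 / (Nat.factorial (m - 1) : ℝ)) *
                  ∫ s in t..R, f s * s ^ (-(m : ℝ)) * (s - t) ^ (m - 1)) t) ^ (n - d))) ≤
          ENNReal.ofReal C := by
  obtain ⟨-, hR1⟩ := hR
  set p := n - d with hp
  have hp2 : 2 ≤ p := by omega
  have hp1 : (1 : ℝ) < p := by exact_mod_cast hp2
  have hp0 : (0 : ℝ) < (p : ℝ) - 1 := by linarith
  refine ⟨(2 * ((p : ℝ) - 1)) ^ ((p : ℝ) - 1) * 2, by positivity, fun f hf hf0 _ hf1 => ?_⟩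
  set g : ℝ → ℝ≥0∞ := indicator (Ioo 0 1) fun s => ‖f s‖ₑ with hg
  have hgm : Measurable g := hf.enorm.indicator measurableSet_Ioo
  have hnorm : ∫⁻ s in Ioi (0 : ℝ), g s ^ (p : ℝ) ≤ 1 := by
    refine le_trans (le_of_eq ?_) hf1
    rw [← lintegral_indicator measurableSet_Ioi, ← lintegral_indicator measurableSet_Ioo]
    congr 1 with s
    by_cases hs : s ∈ Ioo (0 : ℝ) 1
    · rw [indicator_of_mem (show s ∈ Ioi (0 : ℝ) from hs.1), indicator_of_mem hs, hg,
        indicator_of_mem hs, ENNReal.rpow_natCast, Real.enorm_of_nonneg (hf0 s hs),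
        ENNReal.ofReal_pow (hf0 s hs)]
    · rw [indicator_of_notMem hs, indicator_apply_eq_zero]
      intro _
      rw [hg, indicator_of_notMem hs, ENNReal.zero_rpow_of_pos (by linarith)]
  have hpoint : ∀ t ∈ Ioo (0 : ℝ) 1, ENNReal.ofReal ((indicator (Ioo 0 R)
      (fun t => (1 / (Nat.factorial (m - 1) : ℝ)) *
        ∫ s in t..R, f s * s ^ (-(m : ℝ)) * (s - t) ^ (m - 1)) t) ^ p) ≤
      (∫⁻ s in Ioi t, g s * ENNReal.ofReal s⁻¹) ^ (p : ℝ) := by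
    intro t _
    refine (Real.ofReal_le_enorm _).trans ?_
    rw [enorm_pow, ENNReal.rpow_natCast]
    refine pow_le_pow_left' ?_ p
    by_cases ht : t ∈ Ioo 0 R
    swap
    · simp [indicator_of_notMem ht]
    rw [indicator_of_mem ht, enorm_mul, intervalIntegral.integral_of_le ht.2.le]
    have hc : ‖1 / (Nat.factorial (m - 1) : ℝ)‖ₑ ≤ 1 := by
      rw [Real.enorm_of_nonneg (by positivity), ENNReal.ofReal_le_one]
      exact div_le_one_of_le₀ (by exact_mod_cast Nat.factorial_pos _) (by positivity)
    refine (mul_le_of_le_one_left' hc).trans ((enorm_integral_le_lintegral_enorm _).trans ?_)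
    refine le_trans ?_ (lintegral_mono_set (Ioc_subset_Ioi_self (a := R)))
    refine setLIntegral_mono' measurableSet_Ioc fun s hs => ?_
    have hs0 : 0 < s := ht.1.trans hs.1
    have hst : 0 ≤ s - t := by linarith [hs.1]
    rw [hg, indicator_of_mem (show s ∈ Ioo (0 : ℝ) 1 from ⟨hs0, hs.2.trans_lt hR1⟩), mul_assoc,
      enorm_mul, Real.enorm_of_nonneg (r := s ^ (-(m : ℝ)) * (s - t) ^ (m - 1)) (by positivity)]
    gcongr
    exact rpow_neg_mul_sub_pow_le_inv hm ht.1 hs.1.le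
  calc _ ≤ ∫⁻ t in Ioo (0 : ℝ) 1, (∫⁻ s in Ioi t, g s * ENNReal.ofReal s⁻¹) ^ (p : ℝ) :=
        setLIntegral_mono' measurableSet_Ioo hpoint
    _ ≤ ∫⁻ t in Ioi (0 : ℝ), (∫⁻ s in Ioi t, g s * ENNReal.ofReal s⁻¹) ^ (p : ℝ) :=
        lintegral_mono_set Ioo_subset_Ioi_self
    _ ≤ _ := lintegral_lintegral_Ioi_mul_inv_rpow_le hp1 hgm
    _ ≤ _ := mul_le_of_le_one_right' hnorm
end

section
/- Let n, m, d ∈ ℕ with n ≥ 2 and d < n − m, let R ∈ (0,1), and for non-increasing measurable f : (0,1) → [0,∞) define Hf(t) = χ_{(0,R)}(t) · (1/(m−1)!) ∫_t^R f(s) s^{−m} (s−t)^{m−1} ds, t ∈ (0,1). Let ‖·‖_X be a rearrangement-invariant function norm on (0,1). If sup_{f ∈ Λ_{n,d}} ‖Hf‖_X < ∞, then L^{n−d}(0,1) embeds into X(0,1): there exists a constant C such that ‖g‖_X ≤ C (∫₀¹ g(t)^{n−d} dt)^{1/(n−d)} for every measurable g : (0,1) → [0,∞). -/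
open MeasureTheory Set
open scoped ENNReal NNReal

/-- Lebesgue measure on the interval `(0,1)`. -/
noncomputable def vol01 : MeasureTheory.Measure ℝ :=
  MeasureTheory.volume.restrict (Set.Ioo 0 1)

/-- The non-increasing rearrangement on `(0,1)` of an extended-nonnegative function. -/
noncomputable def decRearr (f : ℝ → ℝ≥0∞) (s : ℝ) : ℝ≥0∞ :=
  sInf {ρ : ℝ≥0∞ | vol01 {t | ρ < f t} ≤ ENNReal.ofReal s}

/-- The non-increasing rearrangement of a real-valued function with respect to a measure. -/
noncomputable def rearr {α : Type*} [MeasurableSpace α] (ν : MeasureTheory.Measure α)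
    (u : α → ℝ) (s : ℝ) : ℝ≥0∞ :=
  sInf {ρ : ℝ≥0∞ | ν {x | ρ < ENNReal.ofReal |u x|} ≤ ENNReal.ofReal s}

/-- A rearrangement-invariant function norm on `(0,1)`: properties (P1)–(P6). -/
structure IsRINorm (N : (ℝ → ℝ≥0∞) → ℝ≥0∞) : Prop where
  eq_zero_iff : ∀ f : ℝ → ℝ≥0∞, N f = 0 ↔ (∀ᵐ t ∂vol01, f t = 0)
  smul : ∀ (c : ℝ≥0) (f : ℝ → ℝ≥0∞), N (fun t => (c : ℝ≥0∞) * f t) = (c : ℝ≥0∞) * N f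
  add_le : ∀ f g : ℝ → ℝ≥0∞, N (fun t => f t + g t) ≤ N f + N g
  mono : ∀ f g : ℝ → ℝ≥0∞, (∀ᵐ t ∂vol01, f t ≤ g t) → N f ≤ N g
  iSup_eq : ∀ (f : ℕ → ℝ → ℝ≥0∞) (g : ℝ → ℝ≥0∞),
    (∀ k, ∀ᵐ t ∂vol01, f k t ≤ f (k + 1) t) →
    (∀ᵐ t ∂vol01, (⨆ k, f k t) = g t) → N g = ⨆ k, N (f k)
  indicator_lt_top : ∀ E : Set ℝ, MeasurableSet E → E ⊆ Set.Ioo 0 1 → N (E.indicator 1) < ⊤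
  exists_integral_le : ∀ E : Set ℝ, MeasurableSet E → E ⊆ Set.Ioo 0 1 →
    ∃ C : ℝ≥0, ∀ f : ℝ → ℝ≥0∞, (∫⁻ t in E, f t) ≤ (C : ℝ≥0∞) * N f
  rearr_invariant : ∀ f g : ℝ → ℝ≥0∞, decRearr f = decRearr g → N f = N g

/-- The Hardy-type operator `S₁f(t) = ∫_{t^{n/d}}^1 f(s) s^{-1+m/n} ds`. -/
noncomputable def S1 (n m : ℕ) (d : ℝ) (f : ℝ → ℝ≥0∞) (t : ℝ) : ℝ≥0∞ :=
  ∫⁻ s in Set.Ioo (t ^ ((n : ℝ) / d)) 1, ENNReal.ofReal (s ^ ((m : ℝ) / n - 1)) * f s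

/-- The Hardy-type operator
`S₂f(t) = t^{-m/(n-d)} ∫_0^{t^{n/d}} f(s) s^{-1+m/(n-d)} ds`. -/
noncomputable def S2 (n m : ℕ) (d : ℝ) (f : ℝ → ℝ≥0∞) (t : ℝ) : ℝ≥0∞ :=
  ENNReal.ofReal (t ^ (-((m : ℝ) / ((n : ℝ) - d)))) *
    ∫⁻ s in Set.Ioo (0 : ℝ) (t ^ ((n : ℝ) / d)),
      ENNReal.ofReal (s ^ ((m : ℝ) / ((n : ℝ) - d) - 1)) * f s

lemma lt_decRearr_iff (g : ℝ → ℝ≥0∞) (ρ : ℝ≥0∞) (t : ℝ) :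
    ρ < decRearr g t ↔ ENNReal.ofReal t < vol01 {x | ρ < g x} := by
  constructor
  · intro h
    by_contra! h'
    exact h.not_ge (sInf_le h')
  · intro h
    have hρ : ρ ≠ ⊤ := by
      rintro rfl
      simp at h
    obtain ⟨σ, hanti, hσ, hlim⟩ := exists_seq_strictAnti_tendsto' (lt_top_iff_ne_top.mpr hρ)
    have hU : {x | ρ < g x} = ⋃ k, {x | σ k < g x} := by
      ext x
      simp only [mem_ofPred_eq, mem_iUnion]
      constructor
      · intro hx
        exact ((hlim.eventually (gt_mem_nhds hx)).exists)
      · rintro ⟨k, hk⟩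
        exact (hσ k).1.trans hk
    have hmono : Monotone fun k => {x | σ k < g x} := fun i j hij x hx =>
      lt_of_le_of_lt (hanti.antitone hij) hx
    rw [hU, hmono.measure_iUnion, lt_iSup_iff] at h
    obtain ⟨k, hk⟩ := h
    refine (hσ k).1.trans_le (le_sInf fun τ hτ => ?_)
    by_contra! hlt
    refine absurd (hk.trans_le ((measure_mono fun x hx => ?_).trans hτ)) (lt_irrefl _)
    exact hlt.trans hx

lemma vol01_univ : vol01 univ = 1 := by
  simp [vol01]

lemma vol01_lt_decRearr (g : ℝ → ℝ≥0∞) (ρ : ℝ≥0∞) :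
    vol01 {t | ρ < decRearr g t} = vol01 {x | ρ < g x} := by
  simp only [lt_decRearr_iff]
  set a := vol01 {x | ρ < g x} with ha
  have ha1 : a ≤ 1 := by
    rw [← vol01_univ]
    exact measure_mono (subset_univ _)
  have hat : a ≠ ⊤ := ne_top_of_le_ne_top ENNReal.one_ne_top ha1
  have hr1 : a.toReal ≤ 1 := ENNReal.toReal_le_of_le_ofReal zero_le_one (by simpa using ha1)
  have hset : {t : ℝ | ENNReal.ofReal t < a} ∩ Ioo 0 1 = Ioo 0 a.toReal := by
    ext t
    simp only [mem_inter_iff, mem_ofPred_eq, mem_Ioo]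
    constructor
    · rintro ⟨h1, h2, -⟩
      exact ⟨h2, (ENNReal.ofReal_lt_iff_lt_toReal h2.le hat).1 h1⟩
    · rintro ⟨h1, h2⟩
      exact ⟨(ENNReal.ofReal_lt_iff_lt_toReal h1.le hat).2 h2, h1, h2.trans_le hr1⟩
  rw [vol01, Measure.restrict_apply' measurableSet_Ioo, hset, Real.volume_Ioo, sub_zero,
    ENNReal.ofReal_toReal hat]

lemma decRearr_decRearr (g : ℝ → ℝ≥0∞) : decRearr (decRearr g) = decRearr g := by
  funext s
  rw [decRearr]
  simp only [vol01_lt_decRearr]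
  rfl

lemma antitone_decRearr (g : ℝ → ℝ≥0∞) : Antitone (decRearr g) := fun _ _ hst =>
  sInf_le_sInf fun _ hρ => le_trans hρ (ENNReal.ofReal_le_ofReal hst)

lemma lintegral_comp_decRearr {g : ℝ → ℝ≥0∞} (hg : Measurable g) {φ : ℝ≥0∞ → ℝ≥0∞}
    (hφ : Measurable φ) : ∫⁻ t, φ (decRearr g t) ∂vol01 = ∫⁻ t, φ (g t) ∂vol01 := by
  have hu := (antitone_decRearr g).measurable
  have : IsFiniteMeasure vol01 := ⟨by simp [vol01_univ]⟩
  have hmap : vol01.map (decRearr g) = vol01.map g := by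
    refine Measure.ext_of_Iic _ _ fun ρ => ?_
    rw [← compl_Ioi, Measure.map_apply hu measurableSet_Ioi.compl,
      Measure.map_apply hg measurableSet_Ioi.compl, preimage_compl, preimage_compl,
      measure_compl (hu measurableSet_Ioi) (measure_ne_top _ _),
      measure_compl (hg measurableSet_Ioi) (measure_ne_top _ _)]
    exact congrArg _ (vol01_lt_decRearr g ρ)
  rw [← lintegral_map hφ hu, hmap, lintegral_map hφ hg]

lemma decRearr_lt_top {g : ℝ → ℝ≥0∞} (h : ∀ᵐ t ∂vol01, decRearr g t < ⊤) {t : ℝ} (ht : 0 < t) :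
    decRearr g t < ⊤ := by
  have hs : vol01 (Ioo 0 t) ≠ 0 := by
    have : Ioo 0 t ∩ Ioo 0 1 = Ioo (0 : ℝ) (min t 1) := by
      rw [Ioo_inter_Ioo, max_self]
    rw [vol01, Measure.restrict_apply measurableSet_Ioo, this, Real.volume_Ioo]
    simpa using ht
  by_contra hcon
  refine hs (measure_mono_null (fun s hs => ?_) h)
  exact fun hlt => hcon ((antitone_decRearr g hs.2.le).trans_lt hlt)

lemma lintegral_comp_half_le (φ : ℝ → ℝ≥0∞) (hφ : Measurable φ) :
    ∫⁻ t in Ioo (0 : ℝ) 1, φ (t / 2) ≤ 2 * ∫⁻ t in Ioo (0 : ℝ) 1, φ t := by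
  have hF : Measurable ((Ioo (0 : ℝ) 1).indicator φ) := hφ.indicator measurableSet_Ioo
  have h2 : (2 : ℝ≥0∞) * ∫⁻ t in Ioo (0 : ℝ) 1, φ t
      = ∫⁻ t, (Ioo (0 : ℝ) 1).indicator φ (2⁻¹ * t) := by
    rw [← lintegral_indicator measurableSet_Ioo]
    conv_lhs => rw [← Real.smul_map_volume_mul_left (a := 2⁻¹) (by norm_num)]
    rw [lintegral_smul_measure, lintegral_map hF (by fun_prop), smul_eq_mul, ← mul_assoc,
      abs_of_pos (by norm_num), ENNReal.ofReal_inv_of_pos (by norm_num), ENNReal.ofReal_ofNat,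
      ENNReal.mul_inv_cancel (by norm_num) (by norm_num), one_mul]
  rw [h2, ← lintegral_indicator measurableSet_Ioo]
  refine lintegral_mono fun t => ?_
  by_cases ht : t ∈ Ioo (0 : ℝ) 1
  · have ht' : 2⁻¹ * t ∈ Ioo (0 : ℝ) 1 := ⟨by linarith [ht.1], by linarith [ht.1, ht.2]⟩
    rw [indicator_of_mem ht, indicator_of_mem ht', div_eq_inv_mul]
  · simp [ht]

lemma hardy_lower_bound {m : ℕ} (hm : 1 ≤ m) {R : ℝ} (hR : R < 1) {f : ℝ → ℝ}
    (hf0 : ∀ t ∈ Ioo (0 : ℝ) 1, 0 ≤ f t) (hf : AntitoneOn f (Ioo 0 1)) {t : ℝ} (ht : 0 < t)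
    (htR : t < R / 2) :
    (1 / (Nat.factorial (m - 1) : ℝ)) * (((2 : ℝ) ^ m)⁻¹ / m) * f (2 * t) ≤
      (1 / (Nat.factorial (m - 1) : ℝ)) *
        ∫ s in t..R, f s * s ^ (-(m : ℝ)) * (s - t) ^ (m - 1) := by
  rw [mul_assoc]
  refine mul_le_mul_of_nonneg_left ?_ (by positivity)
  have hsub : ∀ {s}, s ∈ Icc t R → s ∈ Ioo (0 : ℝ) 1 := fun hs =>
    ⟨ht.trans_le hs.1, hs.2.trans_lt hR⟩
  have hint : IntervalIntegrable (fun s => f s * s ^ (-(m : ℝ)) * (s - t) ^ (m - 1)) volume t R := by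
    have htR' : t ≤ R := by linarith
    rw [← uIcc_of_le htR'] at hsub
    have hfi : IntervalIntegrable f volume t R :=
      (hf.mono fun s hs => hsub hs).intervalIntegrable
    refine (hfi.mul_continuousOn ?_).mul_continuousOn (by fun_prop)
    exact continuousOn_id.rpow_const fun s hs => Or.inl (hsub hs).1.ne'
  have hint1 := hint.mono_set (c := t) (d := 2 * t) (by
    rw [uIcc_of_le (by linarith), uIcc_of_le (by linarith)]
    exact Icc_subset_Icc_right (by linarith))
  have hint2 := hint.mono_set (c := 2 * t) (d := R) (by
    rw [uIcc_of_le (by linarith), uIcc_of_le (by linarith)]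
    exact Icc_subset_Icc_left (by linarith))
  have hpos : 0 ≤ ∫ s in (2 * t)..R, f s * s ^ (-(m : ℝ)) * (s - t) ^ (m - 1) := by
    refine intervalIntegral.integral_nonneg (by linarith) fun s hs => ?_
    have hs' : s ∈ Icc t R := ⟨by linarith [hs.1], hs.2⟩
    have h0 := (hsub hs').1
    have h1 : 0 ≤ s - t := by linarith [hs'.1]
    have := hf0 s (hsub hs')
    positivity
  have h2t : 2 * t ∈ Ioo (0 : ℝ) 1 := ⟨by linarith, by linarith⟩
  have hlow : ∫ s in t..(2 * t), f (2 * t) * (2 * t) ^ (-(m : ℝ)) * (s - t) ^ (m - 1) ≤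
      ∫ s in t..(2 * t), f s * s ^ (-(m : ℝ)) * (s - t) ^ (m - 1) := by
    refine intervalIntegral.integral_mono_on (by linarith)
      (Continuous.intervalIntegrable (by fun_prop) _ _) hint1 fun s hs => ?_
    have hs' : s ∈ Icc t R := ⟨hs.1, by linarith [hs.2]⟩
    have h0 := (hsub hs').1
    have h1 : 0 ≤ s - t := by linarith [hs'.1]
    refine mul_le_mul_of_nonneg_right (mul_le_mul (hf (hsub hs') h2t hs.2) ?_ (by positivity)
      (hf0 s (hsub hs'))) (by positivity)
    exact Real.rpow_le_rpow_of_nonpos h0 hs.2 (by simp)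
  have hval : ∫ s in t..(2 * t), f (2 * t) * (2 * t) ^ (-(m : ℝ)) * (s - t) ^ (m - 1) =
      ((2 : ℝ) ^ m)⁻¹ / m * f (2 * t) := by
    rw [intervalIntegral.integral_const_mul,
      intervalIntegral.integral_comp_sub_right (fun x => x ^ (m - 1)), integral_pow,
      Real.rpow_neg (by linarith), Real.rpow_natCast, mul_pow, Nat.sub_add_cancel hm,
      Nat.cast_sub hm, sub_self, zero_pow (by omega)]
    have : (m : ℝ) ≠ 0 := by positivity
    have : t ≠ 0 := ht.ne'
    rw [show 2 * t - t = t by ring, Nat.cast_one, sub_add_cancel]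
    field_simp
    ring
  rw [← intervalIntegral.integral_add_adjacent_intervals hint1 hint2]
  linarith

lemma exists_norm_le_of_small_support {q m : ℕ} (hq : 1 ≤ q) (hm : 1 ≤ m) {R : ℝ}
    (hR : R < 1) {N : (ℝ → ℝ≥0∞) → ℝ≥0∞} (hN : IsRINorm N) {B : ℝ≥0∞} (hB : B ≠ ⊤)
    (hsup : ∀ f : ℝ → ℝ, Measurable f → (∀ t ∈ Set.Ioo (0 : ℝ) 1, 0 ≤ f t) →
      AntitoneOn f (Set.Ioo 0 1) →
      (∫⁻ t in Set.Ioo (0 : ℝ) 1, ENNReal.ofReal (f t ^ q)) ≤ 1 →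
      N (fun t => ENNReal.ofReal
          (Set.indicator (Set.Ioo 0 R)
            (fun t => (1 / (Nat.factorial (m - 1) : ℝ)) *
              ∫ s in t..R, f s * s ^ (-(m : ℝ)) * (s - t) ^ (m - 1)) t)) ≤ B) :
    ∃ C : ℝ≥0∞, C ≠ ⊤ ∧ ∀ h : ℝ → ℝ≥0∞, Measurable h →
      vol01 {x | 0 < h x} ≤ ENNReal.ofReal (R / 2) →
      N h ≤ C * (∫⁻ t in Set.Ioo (0 : ℝ) 1, h t ^ q) ^ (1 / (q : ℝ)) := by
  set c : ℝ := (1 / (Nat.factorial (m - 1) : ℝ)) * (((2 : ℝ) ^ m)⁻¹ / m) with hc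
  have hc0 : 0 < c := by positivity
  refine ⟨(ENNReal.ofReal c)⁻¹ * 2 * B + 1, ?_, fun h hh hsupp => ?_⟩
  · have : (ENNReal.ofReal c)⁻¹ ≠ ⊤ := by simpa using hc0
    finiteness
  set I := ∫⁻ t in Set.Ioo (0 : ℝ) 1, h t ^ q with hI
  set A := I ^ (1 / (q : ℝ)) with hA
  have hAI : A ^ q = I := by
    rw [hA, ← ENNReal.rpow_mul_natCast, one_div_mul_cancel (by positivity), ENNReal.rpow_one]
  rcases eq_or_ne A ⊤ with hAt | hAt
  · rw [hAt, ENNReal.mul_top (by simp)]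
    exact le_top
  rcases eq_or_ne A 0 with hA0 | hA0
  · have hI0 : I = 0 := by rw [← hAI, hA0, zero_pow (by omega)]
    have : N h = 0 := by
      rw [hN.eq_zero_iff]
      filter_upwards [(lintegral_eq_zero_iff (by fun_prop)).1 hI0] with t ht
      exact pow_eq_zero_iff (by omega) |>.1 ht
    rw [this]
    exact zero_le
  set u := decRearr h with hu
  have hum : Measurable u := (antitone_decRearr h).measurable
  have huI : ∫⁻ t in Ioo (0 : ℝ) 1, u t ^ q = I :=
    lintegral_comp_decRearr hh (φ := fun x => x ^ q) (by fun_prop)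
  have huae : ∀ᵐ t ∂vol01, u t < ⊤ := by
    have hIt : ∫⁻ t in Ioo (0 : ℝ) 1, u t ^ q ≠ ⊤ := by
      rw [huI, ← hAI]
      finiteness
    filter_upwards [ae_lt_top (by fun_prop) hIt] with t ht
    exact lt_top_iff_ne_top.2 fun htop => by simp [htop, show q ≠ 0 by omega] at ht
  have hut : ∀ {t}, 0 < t → u t ≠ ⊤ := fun ht => (decRearr_lt_top huae ht).ne
  set l := (2 * A)⁻¹ with hl
  have hlt : l ≠ ⊤ := by simp [hl, hA0]
  have hl0 : l ≠ 0 := by simp [hl, ENNReal.mul_eq_top, hAt]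
  have hlA : l * A = 2⁻¹ := by
    rw [hl, ENNReal.mul_inv (by simp) (by simp), mul_assoc, ENNReal.inv_mul_cancel hA0 hAt, mul_one]
  let f : ℝ → ℝ := fun s => (l * u (s / 2)).toReal
  have hfanti : AntitoneOn f (Ioo 0 1) := fun s hs t ht hst =>
    ENNReal.toReal_mono (ENNReal.mul_ne_top hlt (hut (by linarith [hs.1])))
      (mul_le_mul_right (antitone_decRearr h (by linarith)) l)
  have hf0 : ∀ t ∈ Ioo (0 : ℝ) 1, 0 ≤ f t := fun _ _ => ENNReal.toReal_nonneg
  have hfI : ∫⁻ t in Ioo (0 : ℝ) 1, ENNReal.ofReal (f t ^ q) ≤ 1 := by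
    calc ∫⁻ t in Ioo (0 : ℝ) 1, ENNReal.ofReal (f t ^ q)
        ≤ ∫⁻ t in Ioo (0 : ℝ) 1, l ^ q * u (t / 2) ^ q := by
          refine lintegral_mono fun t => ?_
          rw [ENNReal.ofReal_pow ENNReal.toReal_nonneg, ← mul_pow]
          exact pow_le_pow_left' ENNReal.ofReal_toReal_le q
      _ = l ^ q * ∫⁻ t in Ioo (0 : ℝ) 1, u (t / 2) ^ q := by
          rw [lintegral_const_mul _ (by fun_prop)]
      _ ≤ l ^ q * (2 * A ^ q) := by
          rw [hAI, ← huI]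
          exact mul_le_mul_right (lintegral_comp_half_le (fun t => u t ^ q) (by fun_prop)) _
      _ = 2⁻¹ ^ q * 2 := by rw [← hlA]; ring
      _ ≤ 2⁻¹ * 2 := by
          gcongr
          exact pow_le_of_le_one (by simp) (by simp) (by omega)
      _ = 1 := ENNReal.inv_mul_cancel (by simp) (by simp)
  have key := hsup f (by fun_prop) hf0 hfanti hfI
  set K : ℝ≥0∞ := ENNReal.ofReal c * l with hK
  have hKt : K ≠ ⊤ := by finiteness
  have hK0 : K ≠ 0 := by simp [hK, hc0, hl0]
  have hKu : K * N u ≤ B := by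
    rw [← ENNReal.coe_toNNReal hKt, ← hN.smul]
    refine (hN.mono _ _ ?_).trans key
    rw [vol01]
    filter_upwards [ae_restrict_mem measurableSet_Ioo] with t ht
    rcases lt_or_ge t (R / 2) with htR | htR
    · have hlow := hardy_lower_bound hm hR hf0 hfanti ht.1 htR
      have htm : t ∈ Ioo 0 R := ⟨ht.1, by linarith [ht.1]⟩
      rw [indicator_of_mem htm]
      refine le_trans (le_of_eq ?_) (ENNReal.ofReal_le_ofReal hlow)
      rw [ENNReal.coe_toNNReal hKt, ← hc, ENNReal.ofReal_mul hc0.le, hK]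
      simp only [f]
      rw [mul_div_cancel_left₀ t two_ne_zero,
        ENNReal.ofReal_toReal (ENNReal.mul_ne_top hlt (hut ht.1)), mul_assoc]
    · have : u t = 0 := by
        by_contra hne
        have := (lt_decRearr_iff h 0 t).1 (pos_iff_ne_zero.2 hne)
        exact (this.trans_le hsupp).not_ge (ENNReal.ofReal_le_ofReal htR)
      simp [this]
  rw [← hN.rearr_invariant _ _ (decRearr_decRearr h)]
  calc N u ≤ B * K⁻¹ := by
        rw [← div_eq_mul_inv, ENNReal.le_div_iff_mul_le (Or.inl hK0) (Or.inl hKt), mul_comm]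
        exact hKu
    _ = (ENNReal.ofReal c)⁻¹ * 2 * B * A := by
        rw [hK, hl, ENNReal.mul_inv (Or.inr hlt) (Or.inr hl0), inv_inv]
        ring
    _ ≤ _ := by
        gcongr
        exact le_self_add

lemma IsRINorm.le_natCast_mul {N : (ℝ → ℝ≥0∞) → ℝ≥0∞} (hN : IsRINorm N) {r : ℝ} (hr : 0 ≤ r)
    {g : ℝ → ℝ≥0∞} {D : ℝ≥0∞} (h : ∀ a, 0 ≤ a → N ((Ioc a (a + r)).indicator g) ≤ D) (k : ℕ) :
    N ((Iic (k * r)).indicator g) ≤ k * D := by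
  induction k with
  | zero =>
    refine le_of_eq_of_le ((hN.eq_zero_iff _).2 ?_) zero_le
    rw [vol01]
    filter_upwards [ae_restrict_mem measurableSet_Ioo] with t ht
    exact indicator_of_notMem (by simpa using ht.1) _
  | succ k ih =>
    have hsplit : (Iic (((k + 1 : ℕ) : ℝ) * r)).indicator g = fun t =>
        (Iic (k * r)).indicator g t + (Ioc (k * r) (k * r + r)).indicator g t := by
      have hE : ((k + 1 : ℕ) : ℝ) * r = k * r + r := by push_cast; ring
      rw [hE, ← Iic_union_Ioc_eq_Iic (a := k * r) (by linarith),
        indicator_union_of_disjoint (Iic_disjoint_Ioc le_rfl)]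
    rw [hsplit]
    refine (hN.add_le _ _).trans ?_
    rw [Nat.cast_succ, add_mul, one_mul]
    exact add_le_add ih (h _ (by positivity))

/-- **Optimality step for the operator `H`:** if a rearrangement-invariant norm `N`
is uniformly bounded on `{Hf : f ∈ Λ_{n,d}}`, then `L^{n-d}(0,1) → X(0,1)`. -/
theorem H_bounded_implies_embedding (n m d : ℕ) (hn : 2 ≤ n) (hm : 1 ≤ m)
    (hd : d + m < n) (R : ℝ) (hR : R ∈ Set.Ioo (0 : ℝ) 1)
    (N : (ℝ → ℝ≥0∞) → ℝ≥0∞) (hN : IsRINorm N)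
    (B : ℝ≥0∞) (hB : B ≠ ⊤)
    (hsup : ∀ f : ℝ → ℝ, Measurable f → (∀ t ∈ Set.Ioo (0 : ℝ) 1, 0 ≤ f t) →
      AntitoneOn f (Set.Ioo 0 1) →
      (∫⁻ t in Set.Ioo (0 : ℝ) 1, ENNReal.ofReal (f t ^ (n - d))) ≤ 1 →
      N (fun t => ENNReal.ofReal
          (Set.indicator (Set.Ioo 0 R)
            (fun t => (1 / (Nat.factorial (m - 1) : ℝ)) *
              ∫ s in t..R, f s * s ^ (-(m : ℝ)) * (s - t) ^ (m - 1)) t)) ≤ B) :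
    ∃ C : ℝ≥0∞, C ≠ ⊤ ∧ ∀ g : ℝ → ℝ≥0∞, Measurable g →
      N g ≤ C * (∫⁻ t in Set.Ioo (0 : ℝ) 1, g t ^ ((n : ℝ) - d)) ^ (1 / ((n : ℝ) - d)) := by
  have hdn : d ≤ n := by omega
  simp only [← Nat.cast_sub hdn, ENNReal.rpow_natCast]
  obtain ⟨C, hC, hCN⟩ := exists_norm_le_of_small_support (by omega) hm hR.2 hN hB hsup
  obtain ⟨k, hk⟩ := exists_nat_ge (R / 2)⁻¹
  have hR0 : 0 < R / 2 := half_pos hR.1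
  have hk1 : 1 ≤ k * (R / 2) := by
    rwa [inv_le_iff_one_le_mul₀ hR0] at hk
  refine ⟨k * C, by finiteness, fun g hg => ?_⟩
  rw [mul_assoc]
  refine le_trans (hN.mono _ _ ?_) (hN.le_natCast_mul hR0.le (g := g) (fun a _ => ?_) k)
  · rw [vol01]
    filter_upwards [ae_restrict_mem measurableSet_Ioo] with t ht
    rw [indicator_of_mem (by exact ht.2.le.trans hk1)]
  · refine (hCN _ (hg.indicator measurableSet_Ioc) ?_).trans ?_
    · calc vol01 {x | 0 < (Ioc a (a + R / 2)).indicator g x}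
          ≤ vol01 (Ioc a (a + R / 2)) := measure_mono fun x hx => by
            by_contra hxa
            simp [indicator_of_notMem hxa] at hx
        _ ≤ volume (Ioc a (a + R / 2)) := Measure.restrict_apply_le _ _
        _ = ENNReal.ofReal (R / 2) := by simp
    · gcongr
      exact indicator_le_self _ _ _
end
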